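/- Let V1, V2, V3 be real normed vector spaces with V1 and V2 complete, let d1 : V1 → V2, d2 : V2 → V3, K : V2 → V1, P : V2 → V2 be continuous linear maps, b11 : V1 × V1 → V2 a continuous symmetric bilinear map and b21 : V2 × V1 → V3 a continuous bilinear map, satisfying d1 ∘ K + K ∘ d2 = id_{V2} − P, the odd Leibniz rule d2(b11(x,y)) = b21(d1 x, y) + b21(d1 y, x), and the cyclic Jacobi identity b21(b11(x,y), z) + b21(b11(y,z), x) + b21(b11(z,x), y) = 0. Fix α ∈ V1 with d1 α = 0, define a_1 = α, S_n = Σ_{j=1}^{n−1} b11(a_j, a_{n−j}) and a_n = −(1/2)·K(S_n) for n ≥ 2, and assume P(S_n) = 0 for all n ≥ 2 and Σ_{n≥1} ‖a_n‖ < ∞. Then the sum D = Σ_{n≥1} a_n satisfies the Maurer–Cartan equation d1 D + (1/2)·b11(D, D) = 0. -/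

import Mathlib

open Finset in
/-- Sums over triples of naturals with a given total, iterated as nested antidiagonals, are
invariant under cyclic rotation of the summand. -/
lemma sum_antidiagonal_antidiagonal_rotate {M : Type*} [AddCommMonoid M]
    (f : ℕ → ℕ → ℕ → M) (n : ℕ) :
    ∑ p ∈ antidiagonal n, ∑ q ∈ antidiagonal p.1, f q.1 q.2 p.2 =
      ∑ p ∈ antidiagonal n, ∑ q ∈ antidiagonal p.1, f q.2 p.2 q.1 := by
  simp only [sum_sigma']
  refine sum_nbij' (fun x => ⟨(x.2.1 + x.1.2, x.2.2), (x.1.2, x.2.1)⟩)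
    (fun x => ⟨(x.2.2 + x.1.2, x.2.1), (x.2.2, x.1.2)⟩) ?_ ?_ ?_ ?_ ?_
  all_goals
    rintro ⟨⟨a, b⟩, ⟨c, d⟩⟩ h
    simp only [mem_sigma, HasAntidiagonal.mem_antidiagonal] at h
    obtain ⟨h1, h2⟩ := h
    subst h2
    subst h1
    simp
  all_goals omega

open Finset in
/-- If a function of three indices has vanishing cyclic sums, then its sum over all triples with
a given total vanishes. -/
lemma sum_antidiagonal_antidiagonal_eq_zero_of_cyclic {M : Type*} [AddCommGroup M] [Module ℝ M]
    (f : ℕ → ℕ → ℕ → M) (hf : ∀ i j k, f i j k + f j k i + f k i j = 0) (n : ℕ) :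
    ∑ p ∈ antidiagonal n, ∑ q ∈ antidiagonal p.1, f q.1 q.2 p.2 = 0 := by
  have h1 := sum_antidiagonal_antidiagonal_rotate f n
  have h2 := sum_antidiagonal_antidiagonal_rotate (fun i j k => f j k i) n
  have h3 : ∑ p ∈ antidiagonal n, ∑ q ∈ antidiagonal p.1,
      (f q.1 q.2 p.2 + f q.2 p.2 q.1 + f p.2 q.1 q.2) = 0 :=
    sum_eq_zero fun p _ => sum_eq_zero fun q _ => hf _ _ _
  simp only [sum_add_distrib] at h3
  rw [← h2, ← h1] at h3
  have h4 : (3 : ℝ) • ∑ p ∈ antidiagonal n, ∑ q ∈ antidiagonal p.1, f q.1 q.2 p.2 = 0 := by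
    rw [← h3]; module
  exact (smul_eq_zero.mp h4).resolve_left (by norm_num)

open Finset in
/-- The Cauchy product of two absolutely summable sequences along a continuous bilinear map. -/
lemma ContinuousLinearMap.hasSum_sum_antidiagonal_of_summable_norm {E F G : Type*}
    [NormedAddCommGroup E] [NormedSpace ℝ E] [CompleteSpace E]
    [NormedAddCommGroup F] [NormedSpace ℝ F] [CompleteSpace F]
    [NormedAddCommGroup G] [NormedSpace ℝ G] [CompleteSpace G]
    (B : E →L[ℝ] F →L[ℝ] G) {f : ℕ → E} {g : ℕ → F}
    (hf : Summable fun n => ‖f n‖) (hg : Summable fun n => ‖g n‖) :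
    HasSum (fun n => ∑ p ∈ antidiagonal n, B (f p.1) (g p.2)) (B (∑' n, f n) (∑' n, g n)) := by
  have hfg : Summable fun p : ℕ × ℕ => B (f p.1) (g p.2) := by
    refine Summable.of_norm_bounded ((hf.mul_of_nonneg hg (fun _ => norm_nonneg _)
      (fun _ => norm_nonneg _)).mul_left ‖B‖) fun p => ?_
    rw [← mul_assoc]
    exact B.le_opNorm₂ _ _
  have h1 : HasSum (fun i => B (f i) (∑' n, g n)) (B (∑' n, f n) (∑' n, g n)) :=
    (B.flip (∑' n, g n)).hasSum hf.of_norm.hasSum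
  have h2 : HasSum (fun p : ℕ × ℕ => B (f p.1) (g p.2)) (B (∑' n, f n) (∑' n, g n)) := by
    rw [h1.unique (hfg.hasSum.prod_fiberwise fun i => (B (f i)).hasSum hg.of_norm.hasSum)]
    exact hfg.hasSum
  have h3 := (HasAntidiagonal.sigmaAntidiagonalEquivProd (A := ℕ)).hasSum_iff.mpr h2
  refine h3.sigma fun n => ?_
  exact (antidiagonal n).hasSum (fun p => B (f p.1) (g p.2))

/-- The convergent sum-over-trees deformation of a smooth flat connection is a
Maurer–Cartan element: `d1 D + (1/2)•b11 D D = 0` for `D = Σ_{n≥1} a n`. -/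
theorem stmt6
    {V1 V2 V3 : Type*}
    [NormedAddCommGroup V1] [NormedSpace ℝ V1] [CompleteSpace V1]
    [NormedAddCommGroup V2] [NormedSpace ℝ V2] [CompleteSpace V2]
    [NormedAddCommGroup V3] [NormedSpace ℝ V3]
    (d1 : V1 →L[ℝ] V2) (d2 : V2 →L[ℝ] V3)
    (K : V2 →L[ℝ] V1) (K' : V3 →L[ℝ] V2) (P : V2 →L[ℝ] V2)
    (b11 : V1 →L[ℝ] V1 →L[ℝ] V2) (b21 : V2 →L[ℝ] V1 →L[ℝ] V3)
    (hb11symm : ∀ x y : V1, b11 x y = b11 y x)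
    (hhomotopy : ∀ v : V2, d1 (K v) + K' (d2 v) = v - P v)
    (hLeibniz : ∀ x y : V1, d2 (b11 x y) = b21 (d1 x) y + b21 (d1 y) x)
    (hJacobi : ∀ x y z : V1,
      b21 (b11 x y) z + b21 (b11 y z) x + b21 (b11 z x) y = 0)
    (α : V1) (hα : d1 α = 0)
    (a : ℕ → V1) (S : ℕ → V2)
    (hS : ∀ n : ℕ, S n = ∑ j ∈ Finset.Ico 1 n, b11 (a j) (a (n - j)))
    (ha1 : a 1 = α)
    (haRec : ∀ n : ℕ, 2 ≤ n → a n = -((1/2 : ℝ) • K (S n)))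
    (hP : ∀ n : ℕ, 2 ≤ n → P (S n) = 0)
    (hsum : Summable (fun n : ℕ => ‖a (n + 1)‖)) :
    d1 (∑' n : ℕ, a (n + 1)) +
      (1/2 : ℝ) • b11 (∑' n : ℕ, a (n + 1)) (∑' n : ℕ, a (n + 1)) = 0 := by
  have hT : ∀ n, S (n + 2) =
      ∑ p ∈ Finset.HasAntidiagonal.antidiagonal n, b11 (a (p.1 + 1)) (a (p.2 + 1)) := by
    intro n
    rw [hS, Finset.Nat.sum_antidiagonal_eq_sum_range_succ_mk, Finset.sum_Ico_eq_sum_range]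
    refine Finset.sum_congr rfl fun k hk => ?_
    have hk' := Finset.mem_range.mp hk
    rw [add_comm 1 k, show n + 2 - (k + 1) = n - k + 1 by omega]
  have hd : ∀ n, d1 (a (n + 2)) = -((1 / 2 : ℝ) • S (n + 2)) := by
    intro n
    induction n using Nat.strong_induction_on with
    | _ n ih =>
      have hd2 : d2 (S (n + 2)) = 0 := by
        have hswap := Finset.Nat.sum_antidiagonal_swap (n := n)
          (f := fun p => b21 (d1 (a (p.1 + 1))) (a (p.2 + 1)))
        simp only [Prod.fst_swap, Prod.snd_swap] at hswap
        simp only [hT, map_sum, hLeibniz, Finset.sum_add_distrib]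
        rw [hswap, ← two_smul ℝ]
        refine smul_eq_zero_of_right _ ?_
        cases n with
        | zero => simp [ha1, hα]
        | succ m =>
          rw [Finset.Nat.sum_antidiagonal_succ]
          have hterm : ∀ p ∈ Finset.HasAntidiagonal.antidiagonal m,
              b21 (d1 (a (p.1 + 1 + 1))) (a (p.2 + 1)) =
                -((1 / 2 : ℝ) • ∑ q ∈ Finset.HasAntidiagonal.antidiagonal p.1,
                  b21 (b11 (a (q.1 + 1)) (a (q.2 + 1))) (a (p.2 + 1))) := by
            intro p hp
            rw [ih p.1 (Nat.lt_succ_of_le (Finset.HasAntidiagonal.antidiagonal.fst_le hp)), hT]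
            simp
          rw [Finset.sum_congr rfl hterm, Finset.sum_neg_distrib, ← Finset.smul_sum,
            sum_antidiagonal_antidiagonal_eq_zero_of_cyclic
              (fun i j k => b21 (b11 (a (i + 1)) (a (j + 1))) (a (k + 1)))
              (fun i j k => hJacobi _ _ _)]
          simp [ha1, hα]
      have h := hhomotopy (S (n + 2))
      rw [hd2, hP _ (by omega), map_zero, add_zero, sub_zero] at h
      rw [haRec _ (by omega), map_neg, map_smul, h]
  have hB := b11.hasSum_sum_antidiagonal_of_summable_norm hsum hsum
  have hD : HasSum (fun n => d1 (a (n + 2))) (d1 (∑' n, a (n + 1))) := by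
    have h := d1.hasSum hsum.of_norm.hasSum
    rw [← hasSum_nat_add_iff' 1] at h
    simpa [ha1, hα] using h
  have h0 := hD.add (hB.const_smul (1 / 2 : ℝ))
  refine h0.unique ?_
  simp only [hd, ← hT, neg_add_cancel]
  exact hasSum_zero
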